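/- q^{|E|} · P_G(q) = q^{|V|} · ∑_{A⊆E} (−1)^{|A|} · (q−1)^{|E|−|A|} · F_{(V,A)}(q), as an identity of integers; this expresses the chromatic polynomial value P_G(q) in terms of the flow polynomial values F_{(V,A)}(q) of all spanning subgraphs of G. -/

import Mathlib

/-- An additive character turns finite sums into finite products. -/
theorem AddChar.map_sum_eq_prod {ι A M : Type*} [AddCommMonoid A] [CommMonoid M]
    (ψ : AddChar A M) (s : Finset ι) (g : ι → A) : ψ (∑ j ∈ s, g j) = ∏ j ∈ s, ψ (g j) :=
  map_prod ψ.toMonoidHom (fun j => Multiplicative.ofAdd (g j)) s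

open Finset in
/-- The exponential sum over all functions on `V` along a fixed vector `c` detects `c = 0`. -/
theorem sum_addChar_sum_mul {V F R : Type*} [Fintype V] [DecidableEq V] [Field F] [Fintype F]
    [CommRing R] [IsDomain R] {ψ : AddChar F R} (hψ : ψ.IsPrimitive) (c : V → F)
    [Decidable (∀ v, c v = 0)] :
    ∑ x : V → F, ψ (∑ v, x v * c v) =
      if ∀ v, c v = 0 then (Fintype.card F : R) ^ Fintype.card V else 0 := by
  classical
  have h : ∑ x : V → F, ψ (∑ v, x v * c v) = ∏ v, ∑ a : F, ψ (a * c v) := by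
    rw [prod_univ_sum, Fintype.piFinset_univ]
    exact sum_congr rfl fun x _ => AddChar.map_sum_eq_prod ψ _ _
  rw [h]
  simp_rw [AddChar.sum_mulShift _ hψ]
  split_ifs with hc
  · simp [hc]
  · obtain ⟨v, hv⟩ := not_forall.mp hc
    exact prod_eq_zero (mem_univ v) (by simp [hv])

open Finset in
/-- Summation by parts on a multigraph: pairing `k` with the coboundary of `x` is pairing `x`
with the net flow of `k`. -/
theorem sum_mul_coboundary {V ι F : Type*} [Fintype V] [DecidableEq V] [Fintype ι] [CommRing F]
    (i f : ι → V) (k : ι → F) (x : V → F) :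
    ∑ e, k e * (x (f e) - x (i e)) =
      ∑ v, x v * ((∑ e with f e = v, k e) - ∑ e with i e = v, k e) := by
  have h (g : ι → V) : ∑ v, x v * ∑ e with g e = v, k e = ∑ e, k e * x (g e) := by
    simp_rw [sum_filter, mul_sum]
    rw [sum_comm]
    simp [mul_comm]
  simp_rw [mul_sub, sum_sub_distrib, h]

open Finset in
/-- Expansion, over the subsets of `E`, of the indicator function of nowhere-zero vectors. -/
theorem card_pow_mul_indicator_ne_zero {E F R : Type*} [Fintype E] [DecidableEq E] [Field F] [Fintype F]
    [CommRing R] [IsDomain R] {ψ : AddChar F R} (hψ : ψ.IsPrimitive) (y : E → F)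
    [DecidableEq F] [Decidable (∀ e, y e ≠ 0)] :
    (Fintype.card F : R) ^ Fintype.card E * (if ∀ e, y e ≠ 0 then 1 else 0) =
      ∑ A : Finset E, (-1) ^ #A * ((Fintype.card F : R) - 1) ^ (Fintype.card E - #A) *
        ∑ k : {e // e ∈ A} → F with ∀ e, k e ≠ 0, ψ (∑ e, k e * y e) := by
  classical
  have h (e : E) : (Fintype.card F : R) * (if y e ≠ 0 then 1 else 0) =
      -(∑ a ∈ univ.filter (· ≠ (0 : F)), ψ (a * y e)) + ((Fintype.card F : R) - 1) := by
    have h₁ := AddChar.sum_mulShift (y e) hψ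
    rw [← add_sum_erase _ _ (mem_univ (0 : F)), zero_mul, AddChar.map_zero_eq_one] at h₁
    rw [filter_ne' univ (0 : F)]
    by_cases hy : y e = 0
    · simp only [hy, if_true] at h₁ ⊢
      simp only [ne_eq, not_true_eq_false, if_false]
      linear_combination h₁
    · simp only [hy, if_false, Nat.cast_zero] at h₁
      simp only [ne_eq, hy, not_false_eq_true, if_true]
      linear_combination h₁
  have h₂ : (Fintype.card F : R) ^ Fintype.card E * (if ∀ e, y e ≠ 0 then 1 else 0) =
      ∏ e, (Fintype.card F : R) * (if y e ≠ 0 then 1 else 0) := by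
    rw [prod_mul_distrib, prod_const, card_univ, Fintype.prod_boole]
    congr
  rw [h₂]
  simp_rw [h]
  rw [prod_add, powerset_univ]
  refine sum_congr rfl fun A _ => ?_
  rw [prod_neg, prod_const, card_sdiff_of_subset (subset_univ A), card_univ,
    ← prod_coe_sort A, prod_univ_sum, mul_right_comm]
  congr 1
  refine sum_congr ?_ fun k _ => (AddChar.map_sum_eq_prod ψ _ _).symm
  ext k
  simp

/-- Let `G = (V,E,i,f)` be a multigraph and `F` a finite field with `q`
elements.  Let `P_G(q)` be the number of proper colorings `x : V → F` (so
`x(i e) ≠ x(f e)` for all `e ∈ E`), and for `A ⊆ E` let `F_{(V,A)}(q)` be the number of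
nowhere-zero flows on the spanning subgraph `(V,A)`, i.e. of `k : A → F` with `k e ≠ 0`
for all `e ∈ A` and `∑_{e∈A, f e = v} k e − ∑_{e∈A, i e = v} k e = 0` for all `v`.  Then
`q^{|E|} · P_G(q) = q^{|V|} · ∑_{A⊆E} (−1)^{|A|} (q−1)^{|E|−|A|} F_{(V,A)}(q)`. -/
theorem stmt_17 {V E F : Type*} [Fintype V] [DecidableEq V] [Fintype E]
    [Field F] [Fintype F]
    (i f : E → V)
    (PG : ℕ)
    (hPG : PG = Nat.card {x : V → F // ∀ e : E, x (i e) ≠ x (f e)})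
    (Fl : Finset E → ℕ)
    (hFl : ∀ A : Finset E,
      Fl A = Nat.card {k : {e // e ∈ A} → F // (∀ e : {e // e ∈ A}, k e ≠ 0) ∧ ∀ v : V,
        (∑ e ∈ Finset.univ.filter (fun e : {e // e ∈ A} => f e.1 = v), k e) -
          (∑ e ∈ Finset.univ.filter (fun e : {e // e ∈ A} => i e.1 = v), k e) = 0}) :
    (Fintype.card F : ℤ) ^ (Fintype.card E) * PG =
      (Fintype.card F : ℤ) ^ (Fintype.card V) *
        ∑ A : Finset E, (-1 : ℤ) ^ A.card *
          ((Fintype.card F : ℤ) - 1) ^ (Fintype.card E - A.card) * Fl A := by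
  classical
  let ψ := AddChar.FiniteField.primitiveChar_to_Complex F
  have hψ : ψ.IsPrimitive := AddChar.FiniteField.primitiveChar_to_Complex_isPrimitive F
  have hP : (PG : ℂ) = ∑ x : V → F, if ∀ e, x (f e) - x (i e) ≠ 0 then 1 else 0 := by
    rw [hPG, Nat.card_eq_fintype_card, Fintype.card_subtype, Finset.sum_boole]
    simp_rw [sub_ne_zero, ne_comm]
  have hF (A : Finset E) : (Fintype.card F : ℂ) ^ Fintype.card V * Fl A =
      ∑ k : {e // e ∈ A} → F with ∀ e, k e ≠ 0,
        ∑ x : V → F, ψ (∑ e, k e * (x (f e) - x (i e))) := by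
    simp_rw [sum_mul_coboundary (fun e : {e // e ∈ A} => i e) (fun e => f e),
      sum_addChar_sum_mul hψ]
    rw [hFl, Nat.card_eq_fintype_card, Fintype.card_subtype, ← Finset.sum_filter,
      Finset.filter_filter, Finset.sum_const, nsmul_eq_mul, mul_comm]
  have key : (Fintype.card F : ℂ) ^ Fintype.card E * PG = (Fintype.card F : ℂ) ^ Fintype.card V *
      ∑ A : Finset E, (-1) ^ A.card *
        ((Fintype.card F : ℂ) - 1) ^ (Fintype.card E - A.card) * Fl A := by
    rw [hP, Finset.mul_sum, Finset.mul_sum]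
    simp_rw [mul_left_comm _ (_ * _ : ℂ), hF, card_pow_mul_indicator_ne_zero hψ]
    rw [Finset.sum_comm]
    refine Finset.sum_congr rfl fun A _ => ?_
    rw [← Finset.mul_sum, Finset.sum_comm]
  exact_mod_cast key
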